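/- arXiv:1012.1215 — 4 statements merged into one kernel-verified Lean document; each statement's English description precedes it below -/
import Mathlib

section
/- Let ψ ∈ ℂ^d ⊗ ℂ^d be a unit vector and ρ = |ψ⟩⟨ψ| the associated pure-state density matrix, regarded as a matrix indexed by (Fin d × Fin d). Then there exist a unitary d×d matrix U and a matrix ρ̃ indexed by (Fin d × Fin d) such that: (i) ρ̃ is symmetric: Tr[(E ⊗ F) ρ̃] = Tr[(F ⊗ E) ρ̃] for all Hermitian d×d matrices E, F (⊗ denoting the Kronecker product); (ii) ρ̃ is positive semidefinite as a bilinear form on Hermitian matrices: Tr[(E ⊗ E) ρ̃] ≥ 0 for all Hermitian E; and (iii) ρ = (𝟙 ⊗ τ)(ρ̃) where τ(X) = U† Xᵀ U, equivalently, Tr[(E ⊗ F) ρ] = Tr[(E ⊗ (U F U†)ᵀ) ρ̃] for all d×d matrices E, F. In particular τ maps positive semidefinite matrices of trace one to positive semidefinite matrices of trace one. -/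
open Matrix Kronecker ComplexOrder


open scoped MatrixOrder in
lemma aux_sqrt {d : ℕ} (A : Matrix (Fin d) (Fin d) ℂ) (hA : A.PosSemidef) :
    ∃ S : Matrix (Fin d) (Fin d) ℂ, S.PosSemidef ∧ S * S = A :=
  ⟨CFC.sqrt A, Matrix.nonneg_iff_posSemidef.mp (CFC.sqrt_nonneg A),
    CFC.sqrt_mul_sqrt_self A hA.nonneg⟩

lemma aux_iso {d : ℕ} (A B : Matrix (Fin d) (Fin d) ℂ) (h : Aᴴ * A = Bᴴ * B) :
    ∃ W : Matrix (Fin d) (Fin d) ℂ, W ∈ Matrix.unitaryGroup (Fin d) ℂ ∧ W * A = B := by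
  set a := Matrix.toEuclideanLin A with ha
  set b := Matrix.toEuclideanLin B with hb
  have hn : ∀ x, ‖a x‖ = ‖b x‖ := by
    have key : ∀ (C : Matrix (Fin d) (Fin d) ℂ) (x : EuclideanSpace ℂ (Fin d)),
        inner ℂ (Matrix.toEuclideanLin C x) (Matrix.toEuclideanLin C x)
          = inner ℂ x (Matrix.toEuclideanLin (Cᴴ * C) x) := by
      intro C x
      have : Matrix.toEuclideanLin (Cᴴ * C) x
          = Matrix.toEuclideanLin Cᴴ (Matrix.toEuclideanLin C x) := by
        simp [Matrix.toLpLin_apply, Matrix.mulVec_mulVec]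
      rw [this, Matrix.toEuclideanLin_conjTranspose_eq_adjoint, LinearMap.adjoint_inner_right]
    intro x
    have h1 := key A x
    have h2 := key B x
    rw [h, ← h2] at h1
    rw [inner_self_eq_norm_sq_to_K, inner_self_eq_norm_sq_to_K] at h1
    have h3 : ‖a x‖ ^ 2 = ‖b x‖ ^ 2 := by exact_mod_cast h1
    exact (pow_left_inj₀ (norm_nonneg _) (norm_nonneg _) two_ne_zero).mp h3
  obtain ⟨s, hs⟩ := a.rangeRestrict.exists_rightInverse_of_surjective a.range_rangeRestrict
  have hs' : ∀ y, a (s y) = y := fun y => by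
    have := congrArg Subtype.val (LinearMap.congr_fun hs y)
    simpa using this
  let L : LinearMap.range a →ₗᵢ[ℂ] EuclideanSpace ℂ (Fin d) :=
    { toLinearMap := b ∘ₗ s
      norm_map' := fun y => by
        simp only [LinearMap.comp_apply]
        rw [← hn, hs' y]; rfl }
  have hL : ∀ x, L.extend (a x) = b x := by
    intro x
    have h1 := L.extend_apply ⟨a x, x, rfl⟩
    have h2 : a (s ⟨a x, x, rfl⟩ - x) = 0 := by rw [map_sub, hs']; simp
    have h3 : b (s ⟨a x, x, rfl⟩ - x) = 0 := by rw [← norm_eq_zero, ← hn, h2, norm_zero]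
    rw [map_sub, sub_eq_zero] at h3
    exact h1.trans h3
  let T := L.extend.toLinearIsometryEquiv rfl
  let e := EuclideanSpace.basisFun (Fin d) ℂ
  refine ⟨LinearMap.toMatrix e.toBasis e.toBasis T.toLinearEquiv.toLinearMap,
    T.toMatrix_mem_unitaryGroup e e, ?_⟩
  apply Matrix.toEuclideanLin.injective
  ext1 x
  have h4 : ∀ (C : Matrix (Fin d) (Fin d) ℂ) x, Matrix.toEuclideanLin (C * A) x
      = Matrix.toEuclideanLin C (Matrix.toEuclideanLin A x) := by
    intro C x
    simp [Matrix.toLpLin_apply, Matrix.mulVec_mulVec]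
  rw [h4, ← hb, ← hL x, Matrix.toEuclideanLin_eq_toLin_orthonormal, Matrix.toLin_toMatrix]
  rfl

lemma aux_polar {d : ℕ} (M : Matrix (Fin d) (Fin d) ℂ) :
    ∃ P V : Matrix (Fin d) (Fin d) ℂ, P.PosSemidef ∧ V ∈ Matrix.unitaryGroup (Fin d) ℂ ∧
      M = P * V := by
  obtain ⟨P, hP, hPP⟩ := aux_sqrt _ (Matrix.posSemidef_self_mul_conjTranspose M)
  obtain ⟨W, hW, h⟩ := aux_iso P Mᴴ (by rw [hP.1.eq, hPP, conjTranspose_conjTranspose])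
  refine ⟨P, Wᴴ, hP, Unitary.star_mem hW, ?_⟩
  rw [← conjTranspose_conjTranspose M, ← h, conjTranspose_mul, hP.1.eq]

lemma aux_trace {d : ℕ} (P E F : Matrix (Fin d) (Fin d) ℂ) :
    ((E ⊗ₖ F) * Matrix.of fun x y : Fin d × Fin d => P x.2 y.1 * P x.1 y.2).trace
      = (P * E * P * F).trace := by
  simp only [Matrix.trace, Matrix.diag, Matrix.mul_apply, Matrix.kroneckerMap_apply,
    Fintype.sum_prod_type, Matrix.of_apply, Finset.sum_mul]
  -- Σ a b c d, E a c F b d P d a P c b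
  rw [Finset.sum_congr rfl fun a _ => Finset.sum_congr rfl fun b _ => Finset.sum_comm]
  rw [Finset.sum_congr rfl fun a _ => Finset.sum_comm]
  rw [Finset.sum_comm]
  refine Finset.sum_congr rfl fun i _ => ?_
  rw [Finset.sum_comm]
  refine Finset.sum_congr rfl fun j _ => ?_
  rw [Finset.sum_comm]
  refine Finset.sum_congr rfl fun k _ => ?_
  refine Finset.sum_congr rfl fun l _ => ?_
  ring

lemma aux_trace_pure {d : ℕ} (ψ : Fin d × Fin d → ℂ) (E F : Matrix (Fin d) (Fin d) ℂ) :
    ((E ⊗ₖ F) * Matrix.vecMulVec ψ (star ψ)).trace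
      = ((Matrix.of fun a b => ψ (a, b))ᴴ * E * (Matrix.of fun a b => ψ (a, b)) * Fᵀ).trace := by
  simp only [Matrix.trace, Matrix.diag, Matrix.mul_apply, Matrix.kroneckerMap_apply,
    Fintype.sum_prod_type, Matrix.of_apply, Finset.sum_mul, Matrix.vecMulVec_apply,
    Matrix.conjTranspose_apply, Matrix.transpose_apply, Pi.star_apply]
  rw [Finset.sum_comm]
  refine Finset.sum_congr rfl fun i _ => ?_
  rw [Finset.sum_congr rfl fun a _ => Finset.sum_comm]
  rw [Finset.sum_comm]
  refine Finset.sum_congr rfl fun j _ => ?_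
  rw [Finset.sum_comm]
  rw [Finset.sum_comm]
  rw [Finset.sum_comm]
  refine Finset.sum_congr rfl fun k _ => ?_
  refine Finset.sum_congr rfl fun l _ => ?_
  ring

/-- **Every pure bipartite quantum state is a transformed inner product state.**
For a unit vector `ψ ∈ ℂ^d ⊗ ℂ^d` with density matrix `ρ = |ψ⟩⟨ψ|`,
there are a unitary `U` and a matrix `ρ̃` (an inner product state: symmetric and
positive semidefinite as a bilinear form on Hermitian matrices) such that
`ρ = (𝟙 ⊗ τ)(ρ̃)` with `τ(X) = U† Xᵀ U`, expressed via the trace rule; moreover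
`τ` maps PSD trace-one matrices to PSD trace-one matrices. -/
theorem pure_state_from_inner_product_state {d : ℕ}
    (ψ : Fin d × Fin d → ℂ) (hψ : ∑ p, Complex.normSq (ψ p) = 1) :
    ∃ (U : Matrix (Fin d) (Fin d) ℂ)
      (ρt : Matrix (Fin d × Fin d) (Fin d × Fin d) ℂ),
      U ∈ Matrix.unitaryGroup (Fin d) ℂ ∧
      (∀ E F : Matrix (Fin d) (Fin d) ℂ, E.IsHermitian → F.IsHermitian →
          ((E ⊗ₖ F) * ρt).trace = ((F ⊗ₖ E) * ρt).trace) ∧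
      (∀ E : Matrix (Fin d) (Fin d) ℂ, E.IsHermitian →
          0 ≤ ((E ⊗ₖ E) * ρt).trace) ∧
      (∀ E F : Matrix (Fin d) (Fin d) ℂ,
          ((E ⊗ₖ F) * Matrix.vecMulVec ψ (star ψ)).trace
            = ((E ⊗ₖ (U * F * Uᴴ)ᵀ) * ρt).trace) ∧
      (∀ X : Matrix (Fin d) (Fin d) ℂ, X.PosSemidef → X.trace = 1 →
          (Uᴴ * Xᵀ * U).PosSemidef ∧ (Uᴴ * Xᵀ * U).trace = 1) := by
  obtain ⟨P, V, hP, hV, hM⟩ := aux_polar (Matrix.of fun a b => ψ (a, b))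
  have hU : V.map star ∈ Matrix.unitaryGroup (Fin d) ℂ :=
    Matrix.map_star_mem_unitaryGroup_iff.mpr hV
  have hUU : V.map star * (V.map star)ᴴ = 1 := Matrix.mem_unitaryGroup_iff.mp hU
  have hH : (V.map star)ᴴ = Vᵀ := by ext i j; simp
  have hT : (V.map star)ᵀ = Vᴴ := by ext i j; simp
  refine ⟨V.map star, Matrix.of fun x y : Fin d × Fin d => P x.2 y.1 * P x.1 y.2, hU,
    ?_, ?_, ?_, ?_⟩
  · intro E F _ _
    rw [aux_trace, aux_trace, Matrix.mul_assoc, Matrix.trace_mul_comm, ← Matrix.mul_assoc]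
  · intro E hE
    rw [aux_trace]
    obtain ⟨S, hS, hSS⟩ := aux_sqrt P hP
    have h1 : (P * E * P * E).trace = ((S * E * S)ᴴ * (S * E * S)).trace := by
      rw [conjTranspose_mul, conjTranspose_mul, hS.1.eq, hE.eq, ← hSS]
      rw [show S * S * E * (S * S) * E = S * (S * E * (S * S) * E) by
        simp only [Matrix.mul_assoc], Matrix.trace_mul_comm]
      simp only [Matrix.mul_assoc]
    rw [h1]
    exact (Matrix.posSemidef_conjTranspose_mul_self _).trace_nonneg
  · intro E F
    rw [aux_trace_pure, aux_trace, hM, conjTranspose_mul, hP.1.eq, transpose_mul, transpose_mul,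
      hT, hH, transpose_transpose]
    rw [show Vᴴ * P * E * (P * V) * Fᵀ = Vᴴ * (P * E * P * V * Fᵀ) by
        simp only [Matrix.mul_assoc], Matrix.trace_mul_comm]
    simp only [Matrix.mul_assoc]
  · intro X hX hX1
    refine ⟨hX.transpose.conjTranspose_mul_mul_same _, ?_⟩
    rw [Matrix.mul_assoc, Matrix.trace_mul_comm, Matrix.mul_assoc, hUU, Matrix.mul_one,
      Matrix.trace_transpose, hX1]
end

section
/- Let n ≥ 4 be even. For all i, j ∈ {1, …, n}, the correlator of the dichotomic measurements {e_i, ē_i} on A and {e_j, ē_j} on B performed on the maximally entangled polygon state φ satisfies E(e_i, e_j) = (1/cos(π/n))·cos(2πi/n − (2j−1)π/n). Consequently, for measurement choices i_0, i_1 for Alice and j_0, j_1 for Bob, the CHSH parameter equals S = |(1/cos(π/n))·Σ_{x,y ∈ {0,1}} (−1)^{xy} cos(2π i_x/n − (2 j_y − 1)π/n)|. -/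
open Matrix Real

noncomputable section PolygonEven

/-- `r_n = sqrt(sec(π/n))`. -/
def rn (n : ℕ) : ℝ := Real.sqrt (1 / Real.cos (π / n))

/-- Effects of the even-`n` polygon model. -/
def eEff (n i : ℕ) : Fin 3 → ℝ :=
  (1 / 2 : ℝ) • ![rn n * Real.cos ((2 * (i : ℝ) - 1) * π / (n : ℝ)),
                  rn n * Real.sin ((2 * (i : ℝ) - 1) * π / (n : ℝ)), 1]

/-- The unit effect. -/
def uEff : Fin 3 → ℝ := ![0, 0, 1]

/-- The maximally entangled state of two even-`n` polygon systems. -/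
def phiEven (n : ℕ) : Matrix (Fin 3) (Fin 3) ℝ :=
  !![Real.cos (π / (n : ℝ)), Real.sin (π / (n : ℝ)), 0;
     -Real.sin (π / (n : ℝ)), Real.cos (π / (n : ℝ)), 0;
     0, 0, 1]

/-- Correlator of the dichotomic measurements with outcome-0 effects `a`, `b`. -/
def corr (n : ℕ) (a b : Fin 3 → ℝ) : ℝ :=
  a ⬝ᵥ phiEven n *ᵥ b + (uEff - a) ⬝ᵥ phiEven n *ᵥ (uEff - b)
    - a ⬝ᵥ phiEven n *ᵥ (uEff - b) - (uEff - a) ⬝ᵥ phiEven n *ᵥ b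

theorem corr_eEff (n : ℕ) (hn : 4 ≤ n) (i j : ℕ) :
    corr n (eEff n i) (eEff n j)
        = (1 / Real.cos (π / (n : ℝ))) *
            Real.cos (2 * π * (i : ℝ) / (n : ℝ) - (2 * (j : ℝ) - 1) * π / (n : ℝ)) := by
  have hn' : (4 : ℝ) ≤ n := by exact_mod_cast hn
  have hc : 0 ≤ Real.cos (π / (n : ℝ)) := by
    apply Real.cos_nonneg_of_neg_pi_div_two_le_of_le
    · have : 0 ≤ π / (n : ℝ) := by positivity
      linarith [Real.pi_pos]
    · apply div_le_div_of_nonneg_left Real.pi_pos.le (by norm_num) (by linarith)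
  have hr : rn n * rn n = 1 / Real.cos (π / (n : ℝ)) :=
    Real.mul_self_sqrt (by positivity)
  have ha : 2 * π * (i : ℝ) / (n : ℝ) - (2 * (j : ℝ) - 1) * π / (n : ℝ)
      = ((2 * (i : ℝ) - 1) * π / (n : ℝ) + π / n) - (2 * (j : ℝ) - 1) * π / (n : ℝ) := by
    ring
  rw [ha, ← hr, Real.cos_sub, Real.cos_add, Real.sin_add]
  simp only [corr, eEff, uEff, phiEven, dotProduct, mulVec, Fin.sum_univ_three, Pi.sub_apply,
    Pi.smul_apply, smul_eq_mul]
  simp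
  ring

/-- Correlators on the maximally entangled state of two even-`n` polygon
systems: `E(e_i, e_j) = sec(π/n) cos(2πi/n − (2j−1)π/n)`; consequently the
CHSH parameter for settings `i₀, i₁` (Alice) and `j₀, j₁` (Bob) equals
`|sec(π/n) ∑_{x,y} (−1)^{xy} cos(2π i_x/n − (2 j_y − 1)π/n)|`. -/
theorem even_polygon_correlators_and_CHSH (n : ℕ) (hn : 4 ≤ n) (hne : Even n) :
    (∀ i j : ℕ, 1 ≤ i → i ≤ n → 1 ≤ j → j ≤ n →
      corr n (eEff n i) (eEff n j)
        = (1 / Real.cos (π / (n : ℝ))) *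
            Real.cos (2 * π * (i : ℝ) / (n : ℝ) - (2 * (j : ℝ) - 1) * π / (n : ℝ))) ∧
    (∀ i₀ i₁ j₀ j₁ : ℕ, 1 ≤ i₀ → i₀ ≤ n → 1 ≤ i₁ → i₁ ≤ n →
        1 ≤ j₀ → j₀ ≤ n → 1 ≤ j₁ → j₁ ≤ n →
      |corr n (eEff n i₀) (eEff n j₀) + corr n (eEff n i₀) (eEff n j₁)
        + corr n (eEff n i₁) (eEff n j₀) - corr n (eEff n i₁) (eEff n j₁)|
      = |(1 / Real.cos (π / (n : ℝ))) *
          (Real.cos (2 * π * (i₀ : ℝ) / (n : ℝ) - (2 * (j₀ : ℝ) - 1) * π / (n : ℝ))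
            + Real.cos (2 * π * (i₀ : ℝ) / (n : ℝ) - (2 * (j₁ : ℝ) - 1) * π / (n : ℝ))
            + Real.cos (2 * π * (i₁ : ℝ) / (n : ℝ) - (2 * (j₀ : ℝ) - 1) * π / (n : ℝ))
            - Real.cos (2 * π * (i₁ : ℝ) / (n : ℝ) - (2 * (j₁ : ℝ) - 1) * π / (n : ℝ)))|) := by
  refine ⟨fun i j _ _ _ _ => corr_eEff n hn i j, ?_⟩
  intro i₀ i₁ j₀ j₁ _ _ _ _ _ _ _ _
  simp only [corr_eEff n hn]
  congr 1
  ring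

end PolygonEven
end

section
/- Let n ≥ 4 be even. There exist indices i_0, i_1, j_0, j_1 ∈ {1, …, n} such that the CHSH parameter obtained from measurements {e_{i_x}, ē_{i_x}} on A and {e_{j_y}, ē_{j_y}} on B on the maximally entangled polygon state φ reaches or exceeds Tsirelson's bound: E(e_{i_0}, e_{j_0}) + E(e_{i_0}, e_{j_1}) + E(e_{i_1}, e_{j_0}) − E(e_{i_1}, e_{j_1}) ≥ 2√2. -/
open Matrix Real

noncomputable section PolygonEven

lemma cos_pos_aux (n : ℕ) (hn : 4 ≤ n) : 0 < Real.cos (π / n) := by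
  have hn' : (4:ℝ) ≤ n := by exact_mod_cast hn
  have h1 : 0 < π / n := by positivity
  have h2 : π / n ≤ π / 4 := div_le_div_of_nonneg_left pi_pos.le (by norm_num) hn'
  exact Real.cos_pos_of_mem_Ioo ⟨by linarith [pi_pos], by linarith [pi_pos]⟩

lemma corr_formula (n : ℕ) (hn : 4 ≤ n) (i j : ℕ) :
    corr n (eEff n i) (eEff n j)
      = Real.cos ((2 * ((i : ℝ) - j) + 1) * (π / n)) / Real.cos (π / n) := by
  have hc := cos_pos_aux n hn
  have hr : rn n * rn n = 1 / Real.cos (π / n) :=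
    Real.mul_self_sqrt (by positivity)
  have e : (2 * ((i : ℝ) - j) + 1) * (π / n)
      = (2 * (i : ℝ) - 1) * π / n - ((2 * (j : ℝ) - 1) * π / n - π / n) := by ring
  rw [e, div_eq_mul_one_div, ← hr, Real.cos_sub, Real.cos_sub _ (π / n), Real.sin_sub]
  simp [corr, eEff, uEff, phiEven, Matrix.mulVec, dotProduct, Fin.sum_univ_three]
  ring

lemma main_aux (p d m : ℝ) (hm : m = π / 4 + d) (hp : 0 < Real.cos p)
    (h : Real.cos p ≤ Real.cos d ^ 3 - Real.sin d ^ 3) :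
    Real.cos (-m) / Real.cos p + Real.cos m / Real.cos p + Real.cos m / Real.cos p
      - Real.cos (3 * m) / Real.cos p ≥ 2 * √2 := by
  rw [← add_div, ← add_div, ← sub_div, ge_iff_le, le_div_iff₀ hp, Real.cos_neg,
    Real.cos_three_mul, hm, Real.cos_add, Real.cos_pi_div_four, Real.sin_pi_div_four]
  have h2 : √2 * √2 = 2 := Real.mul_self_sqrt (by norm_num)
  have hcs := Real.sin_sq_add_cos_sq d
  have key : 2 * √2 * (Real.cos d ^ 3 - Real.sin d ^ 3) =
      Real.cos m + Real.cos m + Real.cos m - (4 * Real.cos m ^ 3 - 3 * Real.cos m) := by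
    rw [hm, Real.cos_add, Real.cos_pi_div_four, Real.sin_pi_div_four]
    generalize Real.cos d = c at *
    generalize Real.sin d = s at *
    have h3 : (√2 / 2 * c - √2 / 2 * s) ^ 3 = √2 / 4 * (c - s) ^ 3 := by
      linear_combination (√2 / 8 * (c - s) ^ 3) * h2
    rw [h3]
    linear_combination (3 * √2 * (c - s)) * hcs
  rw [hm, Real.cos_add, Real.cos_pi_div_four, Real.sin_pi_div_four] at key
  have : 2 * √2 * Real.cos p ≤ 2 * √2 * (Real.cos d ^ 3 - Real.sin d ^ 3) := by gcongr
  linarith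

/-- The settings used when `n` is not divisible by 8. -/
lemma odd_case (n k : ℕ) (hn : 4 ≤ n) (hk : 8 * k + 2 ≤ n) (d : ℝ)
    (hm : (2 * (k : ℝ) + 1) * (π / n) = π / 4 + d)
    (h : Real.cos (π / n) ≤ Real.cos d ^ 3 - Real.sin d ^ 3) :
    ∃ i₀ i₁ j₀ j₁ : ℕ,
      (1 ≤ i₀ ∧ i₀ ≤ n) ∧ (1 ≤ i₁ ∧ i₁ ≤ n) ∧
      (1 ≤ j₀ ∧ j₀ ≤ n) ∧ (1 ≤ j₁ ∧ j₁ ≤ n) ∧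
      corr n (eEff n i₀) (eEff n j₀) + corr n (eEff n i₀) (eEff n j₁)
        + corr n (eEff n i₁) (eEff n j₀) - corr n (eEff n i₁) (eEff n j₁)
        ≥ 2 * Real.sqrt 2 := by
  refine ⟨k + 1, 3 * k + 2, 2 * k + 2, 1, by omega, by omega, by omega, by omega, ?_⟩
  simp only [corr_formula n hn]
  have := main_aux (π / n) d _ hm (cos_pos_aux n hn) h
  generalize π / (n : ℝ) = p at *
  have e1 : (2 * (((k + 1 : ℕ) : ℝ) - ((2 * k + 2 : ℕ) : ℝ)) + 1) * p
      = -((2 * (k : ℝ) + 1) * p) := by push_cast; ring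
  have e2 : (2 * (((k + 1 : ℕ) : ℝ) - ((1 : ℕ) : ℝ)) + 1) * p
      = (2 * (k : ℝ) + 1) * p := by push_cast; ring
  have e3 : (2 * (((3 * k + 2 : ℕ) : ℝ) - ((2 * k + 2 : ℕ) : ℝ)) + 1) * p
      = (2 * (k : ℝ) + 1) * p := by push_cast; ring
  have e4 : (2 * (((3 * k + 2 : ℕ) : ℝ) - ((1 : ℕ) : ℝ)) + 1) * p
      = 3 * ((2 * (k : ℝ) + 1) * p) := by push_cast; ring
  rw [e1, e2, e3, e4]
  exact this

/-- **Even polygons reach or exceed Tsirelson's bound.**  There are measurement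
settings for which the CHSH parameter on the maximally entangled state of two
even-`n` polygon systems is at least `2√2`. -/
theorem even_polygon_exceeds_tsirelson (n : ℕ) (hn : 4 ≤ n) (hne : Even n) :
    ∃ i₀ i₁ j₀ j₁ : ℕ,
      (1 ≤ i₀ ∧ i₀ ≤ n) ∧ (1 ≤ i₁ ∧ i₁ ≤ n) ∧
      (1 ≤ j₀ ∧ j₀ ≤ n) ∧ (1 ≤ j₁ ∧ j₁ ≤ n) ∧
      corr n (eEff n i₀) (eEff n j₀) + corr n (eEff n i₀) (eEff n j₁)
        + corr n (eEff n i₁) (eEff n j₀) - corr n (eEff n i₁) (eEff n j₁)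
        ≥ 2 * Real.sqrt 2 := by
  have hc := cos_pos_aux n hn
  have hn0 : (n : ℝ) ≠ 0 := by positivity
  have hp0 : 0 < π / n := by positivity
  have hp4 : π / n ≤ π / 4 :=
    div_le_div_of_nonneg_left pi_pos.le (by norm_num) (by exact_mod_cast hn)
  have hnp : (n : ℝ) * (π / n) = π := by field_simp
  have hs0 : 0 ≤ Real.sin (π / n / 2) :=
    Real.sin_nonneg_of_nonneg_of_le_pi (by linarith) (by linarith)
  have hs1 := Real.sin_le_one (π / n / 2)
  have hc1 := Real.cos_le_one (π / n / 2)
  have hcs : Real.sin (π / n / 2) ≤ Real.cos (π / n / 2) := by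
    rw [← Real.cos_pi_div_two_sub]
    exact Real.cos_le_cos_of_nonneg_of_le_pi (by linarith) (by linarith) (by linarith)
  have hsq := Real.sin_sq_add_cos_sq (π / n / 2)
  have hdbl : Real.cos (π / n)
      = Real.cos (π / n / 2) ^ 2 - Real.sin (π / n / 2) ^ 2 := by
    rw [← Real.cos_two_mul']
    congr 1
    ring
  have hcases : ∃ k, n = 8 * k ∨ n = 8 * k + 2 ∨ n = 8 * k + 4 ∨ n = 8 * k + 6 := by
    obtain ⟨m, rfl⟩ := hne
    exact ⟨(m + m) / 8, by omega⟩
  obtain ⟨k, hk | hk | hk | hk⟩ := hcases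
  · have hkr : (n : ℝ) = 8 * k := by exact_mod_cast hk
    refine ⟨k + 1, 3 * k + 1, 2 * k + 1, 1, by omega, by omega, by omega, by omega, ?_⟩
    simp only [corr_formula n hn]
    have hkp : (k : ℝ) * (π / n) = π / 8 := by
      have : 8 * (k : ℝ) * (π / n) = π := by rw [← hkr]; exact hnp
      linarith
    generalize π / (n : ℝ) = p at *
    have e1 : (2 * (((k + 1 : ℕ) : ℝ) - ((2 * k + 1 : ℕ) : ℝ)) + 1) * p = p - π / 4 := by
      push_cast; linear_combination (-2) * hkp
    have e2 : (2 * (((k + 1 : ℕ) : ℝ) - ((1 : ℕ) : ℝ)) + 1) * p = p + π / 4 := by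
      push_cast; linear_combination 2 * hkp
    have e3 : (2 * (((3 * k + 1 : ℕ) : ℝ) - ((2 * k + 1 : ℕ) : ℝ)) + 1) * p
        = p + π / 4 := by
      push_cast; linear_combination 2 * hkp
    have e4 : (2 * (((3 * k + 1 : ℕ) : ℝ) - ((1 : ℕ) : ℝ)) + 1) * p
        = π - (π / 4 - p) := by
      push_cast; linear_combination 6 * hkp
    rw [e1, e2, e3, e4, Real.cos_pi_sub, Real.cos_sub, Real.cos_sub, Real.cos_add,
      Real.cos_pi_div_four, Real.sin_pi_div_four]
    apply ge_of_eq
    field_simp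
    ring
  · have hkr : (n : ℝ) = 8 * k + 2 := by exact_mod_cast hk
    refine odd_case n k hn (by omega) (π / n / 2) ?_ ?_
    · have : (8 * (k : ℝ) + 2) * (π / n) = π := by rw [← hkr]; exact hnp
      linarith
    · rw [hdbl]
      generalize Real.cos (π / n / 2) = c at *
      generalize Real.sin (π / n / 2) = s at *
      have e : c ^ 3 - s ^ 3 - (c ^ 2 - s ^ 2) = (c - s) * ((1 - c) * (1 - s)) := by
        linear_combination (c - s) * hsq
      have : 0 ≤ (c - s) * ((1 - c) * (1 - s)) :=
        mul_nonneg (by linarith) (mul_nonneg (by linarith) (by linarith))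
      linarith
  · have hkr : (n : ℝ) = 8 * k + 4 := by exact_mod_cast hk
    refine odd_case n k hn (by omega) 0 ?_ ?_
    · have : (8 * (k : ℝ) + 4) * (π / n) = π := by rw [← hkr]; exact hnp
      linarith
    · simpa using Real.cos_le_one (π / n)
  · have hkr : (n : ℝ) = 8 * k + 6 := by exact_mod_cast hk
    refine odd_case n k hn (by omega) (-(π / n / 2)) ?_ ?_
    · have : (8 * (k : ℝ) + 6) * (π / n) = π := by rw [← hkr]; exact hnp
      linarith
    · rw [hdbl, Real.cos_neg, Real.sin_neg]
      generalize Real.cos (π / n / 2) = c at *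
      generalize Real.sin (π / n / 2) = s at *
      have e : c ^ 3 - (-s) ^ 3 - (c ^ 2 - s ^ 2) = (c + s) * ((1 - c) * (1 + s)) := by
        linear_combination (c + s) * hsq
      have : 0 ≤ (c + s) * ((1 - c) * (1 + s)) :=
        mul_nonneg (by linarith) (mul_nonneg (by linarith) (by linarith))
      linarith

end PolygonEven
end

section
/- Let n ≥ 4 be even and set ε = 1 − cos(2π/n). On the maximally entangled state φ of two n-vertex polygon systems, with Alice's measurements x = 0: {e_1, ē_1}, x = 1: {e_2, ē_2} and Bob's measurements y = 0: {e_1, ē_1}, y = 1: {e_2, ē_2} (outcome 0 corresponding to the unbarred effect), the resulting probability table P(a,b|x,y) satisfies, for all a, b ∈ {0,1} and x, y ∈ {0,1}: P(a,b|x,y) = ε·P^{PR}(a,b|x,y) + (1−ε)·P^{L}(a,b|x,y), where P^{PR}(a,b|x,y) = 1/2 if a ⊕ b = x·(y ⊕ 1) and 0 otherwise, and P^{L}(a,b|x,y) = 1/2 if a ⊕ b = 0 and 0 otherwise. -/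
open Matrix Real

noncomputable section PolygonEven

/-- Outcome-0 effect of measurement `x ∈ {0,1}`: `e₁` for `x = 0`, `e₂` for
`x = 1` (the same on both sides). -/
def measEff (n x : ℕ) : Fin 3 → ℝ := if x = 0 then eEff n 1 else eEff n 2

/-- Probability table of the measurements `x = 0: {e₁, ē₁}`, `x = 1: {e₂, ē₂}`
(Alice) and `y = 0: {e₁, ē₁}`, `y = 1: {e₂, ē₂}` (Bob) on the maximally
entangled state of two even-`n` polygon systems. -/
def Ptable (n a b x y : ℕ) : ℝ :=
  (if a = 0 then measEff n x else uEff - measEff n x) ⬝ᵥ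
    phiEven n *ᵥ (if b = 0 then measEff n y else uEff - measEff n y)

/-- PR-box correlations: `P^{PR}(a,b|x,y) = 1/2` if `a ⊕ b = x·(y ⊕ 1)`,
else `0`. -/
def PPR (a b x y : ℕ) : ℝ :=
  if (a + b) % 2 = x * ((y + 1) % 2) then 1 / 2 else 0

/-- Local correlations: `P^{L}(a,b|x,y) = 1/2` if `a ⊕ b = 0`, else `0`. -/
def PLtab (a b : ℕ) : ℝ := if (a + b) % 2 = 0 then 1 / 2 else 0

/-- **Decomposition of even-polygon correlations into a PR-box part and a
local part** with PR weight `ε = 1 − cos(2π/n)`. -/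
theorem even_polygon_PR_decomposition (n : ℕ) (hn : 4 ≤ n) (hne : Even n)
    (a b x y : ℕ) (ha : a ≤ 1) (hb : b ≤ 1) (hx : x ≤ 1) (hy : y ≤ 1) :
    Ptable n a b x y
      = (1 - Real.cos (2 * π / (n : ℝ))) * PPR a b x y
        + (1 - (1 - Real.cos (2 * π / (n : ℝ)))) * PLtab a b := by
  have hnR : (4 : ℝ) ≤ (n : ℝ) := by exact_mod_cast hn
  have hpos : 0 < Real.cos (π / (n : ℝ)) := by
    apply Real.cos_pos_of_mem_Ioo
    constructor
    · have : 0 < π / (n : ℝ) := div_pos Real.pi_pos (by linarith)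
      linarith [Real.pi_pos]
    · apply div_lt_div_of_pos_left Real.pi_pos (by norm_num) (by linarith)
  have hr : rn n ^ 2 * Real.cos (π / (n : ℝ)) = 1 := by
    unfold rn
    rw [Real.sq_sqrt (by positivity)]
    field_simp
  have h1 : (2 * ((1 : ℕ) : ℝ) - 1) * π / (n : ℝ) = π / n := by push_cast; ring
  have h2 : (2 * ((2 : ℕ) : ℝ) - 1) * π / (n : ℝ) = 3 * (π / n) := by push_cast; ring
  have h3 : 2 * π / (n : ℝ) = 2 * (π / n) := by ring
  have hs := Real.sin_sq_add_cos_sq (π / (n : ℝ))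
  have key : ∀ A B C D : ℝ, (![A, B, 1 / 2] : Fin 3 → ℝ) ⬝ᵥ phiEven n *ᵥ ![C, D, 1 / 2] =
      A * (Real.cos (π / n) * C + Real.sin (π / n) * D)
        + B * (-Real.sin (π / n) * C + Real.cos (π / n) * D) + 1 / 4 := by
    intro A B C D
    simp [phiEven, Matrix.mulVec, dotProduct, Fin.sum_univ_three]
    ring
  have hu : ∀ A B : ℝ, uEff - ![A, B, 1 / 2] = ![-A, -B, 1 / 2] := by
    intro A B
    ext i
    fin_cases i <;> simp [uEff]
    norm_num
  have e1 : eEff n 1 = ![rn n * Real.cos (π / n) / 2, rn n * Real.sin (π / n) / 2, 1 / 2] := by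
    unfold eEff
    rw [h1]
    ext i
    fin_cases i <;> simp <;> ring
  have e2 : eEff n 2 = ![rn n * (4 * Real.cos (π / n) ^ 3 - 3 * Real.cos (π / n)) / 2,
      rn n * (3 * Real.sin (π / n) - 4 * Real.sin (π / n) ^ 3) / 2, 1 / 2] := by
    unfold eEff
    rw [h2, Real.cos_three_mul, Real.sin_three_mul]
    ext i
    fin_cases i <;> simp <;> ring
  rw [h3, Real.cos_two_mul]
  unfold Ptable measEff
  rw [e1, e2]
  generalize Real.cos (π / (n : ℝ)) = c at *
  generalize Real.sin (π / (n : ℝ)) = s at *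
  generalize rn n = r at *
  have hs2 : s ^ 2 = 1 - c ^ 2 := by linarith
  have hs4 : s ^ 4 = (1 - c ^ 2) ^ 2 := by rw [← hs2]; ring
  have hs6 : s ^ 6 = (1 - c ^ 2) ^ 3 := by rw [← hs2]; ring
  interval_cases a <;> interval_cases b <;> interval_cases x <;> interval_cases y <;>
    simp only [hu, key, PPR, PLtab, if_true, one_ne_zero, if_false] <;> norm_num <;>
    grind

end PolygonEven
end
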